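/- arXiv:1405.0533 — 2 statements merged into one kernel-verified Lean document; each statement's English description precedes it below -/
import Mathlib

section
/- Let G be a cubic graph of girth at least 5 that is theta-connected and has at least 14 vertices. If G has a breaker, then G has at most five cycles of length at most 5 (equivalently, at most five pentagons, since theta-connectivity and girth force all short cycles to be pentagons). -/
/-- The edge boundary `δ(X)`: edges of `G` with exactly one end in `X`. -/
def cut {V : Type*} (G : SimpleGraph V) (X : Set V) : Set (Sym2 V) :=
  {e | e ∈ G.edgeSet ∧ ∃ x ∈ X, ∃ y, y ∉ X ∧ e = s(x, y)}

/-- The set of short cycles (length at most 5) of `G`, each recorded by its edge set. -/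
def shortCycleEdgeSets {V : Type*} [DecidableEq V] (G : SimpleGraph V) :
    Set (Finset (Sym2 V)) :=
  {s | ∃ (u : V) (w : G.Walk u u), w.IsCycle ∧ w.length ≤ 5 ∧ w.edges.toFinset = s}

section helpers
set_option linter.unusedSimpArgs false
variable {V : Type*}

/-- The boundary of a set agrees with that of its complement. -/
lemma cut_compl (G : SimpleGraph V) (X : Set V) : cut G Xᶜ = cut G X := by
  ext e
  constructor
  · rintro ⟨he, x, hx, y, hy, rfl⟩
    exact ⟨he, y, by simpa using hy, x, by simpa using hx, Sym2.eq_swap⟩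
  · rintro ⟨he, x, hx, y, hy, rfl⟩
    exact ⟨he, y, by simpa using hy, x, by simpa using hx, Sym2.eq_swap⟩

lemma interedges_le_cut [Fintype V] [DecidableEq V] (G : SimpleGraph V) [DecidableRel G.Adj]
    (Y : Finset V) : (G.interedges Y Yᶜ).card ≤ (cut G (Y : Set V)).ncard := by
  classical
  rw [← Set.ncard_coe_finset]
  refine Set.ncard_le_ncard_of_injOn (fun p : V × V => s(p.1, p.2)) ?_ ?_ (Set.toFinite _)
  · rintro ⟨a, b⟩ h
    simp only [Finset.mem_coe, SimpleGraph.mem_interedges_iff, Finset.mem_compl] at h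
    exact ⟨h.2.2, a, by simpa using h.1, b, by simpa using h.2.1, rfl⟩
  · rintro ⟨a, b⟩ h ⟨a', b'⟩ h' hh
    simp only [Finset.mem_coe, SimpleGraph.mem_interedges_iff, Finset.mem_compl] at h h'
    simp only [Sym2.eq_iff] at hh
    rcases hh with ⟨rfl, rfl⟩ | ⟨rfl, rfl⟩
    · rfl
    · exact absurd h.1 h'.2.1

lemma interedges_sum [Fintype V] [DecidableEq V] (G : SimpleGraph V) [DecidableRel G.Adj]
    (hcubic : G.IsRegularOfDegree 3)
    (Y : Finset V) : (G.interedges Y Y).card + (G.interedges Y Yᶜ).card = 3 * Y.card := by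
  have key : ∀ Z : Finset V, (G.interedges Y Z).card
      = ∑ y ∈ Y, (Z.filter (fun v => G.Adj y v)).card := by
    intro Z
    rw [SimpleGraph.interedges_def, Finset.card_filter, Finset.sum_product]
    exact Finset.sum_congr rfl fun y _ => (Finset.card_filter _ _).symm
  rw [key, key, ← Finset.sum_add_distrib, mul_comm, ← smul_eq_mul, ← Finset.sum_const]
  refine Finset.sum_congr rfl fun y _ => ?_
  rw [← hcubic y, ← SimpleGraph.card_neighborFinset_eq_degree,
    ← Finset.card_union_of_disjoint]
  · congr 1
    ext v
    simp only [Finset.mem_union, Finset.mem_filter, Finset.mem_compl,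
      SimpleGraph.mem_neighborFinset]
    tauto
  · rw [Finset.disjoint_left]
    intro v hv hv'
    simp only [Finset.mem_filter, Finset.mem_compl] at hv hv'
    exact hv'.1 hv.1

/-- An acyclic induced subgraph of a cubic graph has a large boundary. -/
lemma cut_of_acyclic [Fintype V] [DecidableEq V] (G : SimpleGraph V) [DecidableRel G.Adj]
    (hcubic : G.IsRegularOfDegree 3)
    (Y : Finset V) (hY : Y.Nonempty) (hac : (G.induce (Y : Set V)).IsAcyclic) :
    Y.card + 2 ≤ (cut G (Y : Set V)).ncard := by
  classical
  have h1 := interedges_le_cut G Y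
  have h2 := interedges_sum G hcubic Y
  have : Nonempty (Y : Set V) := by
    obtain ⟨y, hy⟩ := hY
    exact ⟨⟨y, hy⟩⟩
  obtain ⟨T, hT, -, hTt⟩ := (SimpleGraph.connected_top (V := (Y : Set V))).exists_isTree_le_of_le_of_isAcyclic
    (H := G.induce (Y : Set V)) le_top hac
  have h3 := hTt.card_edgeFinset
  have h4 : (G.induce (Y : Set V)).edgeFinset.card ≤ T.edgeFinset.card :=
    Finset.card_le_card (SimpleGraph.edgeFinset_mono hT)
  have h5 := (G.induce (Y : Set V)).two_mul_card_edgeFinset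
  have h6 : (G.interedges Y Y).card ≤
      (Finset.univ.filter fun (x, y) ↦ (G.induce (Y : Set V)).Adj x y).card := by
    rw [← Finset.card_map ((Function.Embedding.subtype (· ∈ (Y : Set V))).prodMap
      (Function.Embedding.subtype (· ∈ (Y : Set V))))]
    refine Finset.card_le_card ?_
    rintro ⟨a, b⟩ h
    rw [SimpleGraph.mem_interedges_iff] at h
    simp only [Finset.mem_map, Finset.mem_filter, Finset.mem_univ, true_and]
    exact ⟨(⟨a, h.1⟩, ⟨b, h.2.1⟩), h.2.2, rfl⟩
  have h7 : Fintype.card (Y : Set V) = Y.card := by simp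
  have h8 : (G.interedges Y Y).card ≤ 2 * (G.induce (Y : Set V)).edgeFinset.card := by
    rw [h5]
    convert h6
  omega

/-- A small set avoiding the breaker has a large boundary. -/
lemma cut_of_avoid [Fintype V] [DecidableEq V] (G : SimpleGraph V) [DecidableRel G.Adj]
    (hcubic : G.IsRegularOfDegree 3) (C : Set V)
    (hb : ∀ (v : V) (c' : G.Walk v v), c'.IsCycle → c'.length ≤ 5 → ∃ x, x ∈ C ∧ x ∈ c'.support)
    (Y : Finset V) (hY : Y.Nonempty) (hYC : ∀ x ∈ C, x ∉ Y) (h5 : Y.card ≤ 5) :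
    Y.card + 2 ≤ (cut G (Y : Set V)).ncard := by
  refine cut_of_acyclic G hcubic Y hY ?_
  intro v w hw
  have hlen : w.length ≤ 5 := by
    have h1 := hw.support_nodup
    have h2 := h1.length_le_card
    simp at h2
    omega
  have hm := hw.map (f := (SimpleGraph.Embedding.induce (G := G) (Y : Set V)).toHom)
    (SimpleGraph.Embedding.induce (G := G) (Y : Set V)).injective
  obtain ⟨x, hx, hxs⟩ := hb _ _ hm ((SimpleGraph.Walk.length_map _ _).trans_le hlen)
  simp only [SimpleGraph.Walk.support_map, List.mem_map] at hxs
  obtain ⟨y, -, rfl⟩ := hxs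
  exact hYC _ hx y.2

lemma no_triangle (G : SimpleGraph V) (hg : 5 ≤ G.egirth) {a b c : V}
    (h1 : G.Adj a b) (h2 : G.Adj b c) (h3 : G.Adj c a) : False := by
  have h := SimpleGraph.le_egirth.1 hg a (.cons h1 (.cons h2 (.cons h3 .nil))) (by
    simp [SimpleGraph.Walk.isCycle_def, SimpleGraph.Walk.isTrail_def, h1.ne, h2.ne, h3.ne, h1.ne', h2.ne', h3.ne'])
  simp at h
  exact absurd h (by decide)

lemma no_square (G : SimpleGraph V) (hg : 5 ≤ G.egirth) {a b c d : V}
    (h1 : G.Adj a b) (h2 : G.Adj b c) (h3 : G.Adj c d) (h4 : G.Adj d a)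
    (hac : a ≠ c) (hbd : b ≠ d) : False := by
  have h := SimpleGraph.le_egirth.1 hg a (.cons h1 (.cons h2 (.cons h3 (.cons h4 .nil)))) (by
    simp [SimpleGraph.Walk.isCycle_def, SimpleGraph.Walk.isTrail_def, h1.ne, h2.ne, h3.ne, h4.ne, h1.ne', h2.ne', h3.ne', h4.ne', hac, hac.symm, hbd, hbd.symm])
  simp at h
  exact absurd h (by decide)

/-- A closed walk of length five is a pentagon, so it meets the breaker. -/
lemma pent_meets (G : SimpleGraph V) (hg : 5 ≤ G.egirth) (C : Set V)
    (hb : ∀ (v : V) (c' : G.Walk v v), c'.IsCycle → c'.length ≤ 5 → ∃ x, x ∈ C ∧ x ∈ c'.support)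
    {a b c d e : V}
    (h1 : G.Adj a b) (h2 : G.Adj b c) (h3 : G.Adj c d) (h4 : G.Adj d e) (h5 : G.Adj e a) :
    a ∈ C ∨ b ∈ C ∨ c ∈ C ∨ d ∈ C ∨ e ∈ C := by
  have ac : a ≠ c := by rintro rfl; exact no_triangle G hg h3 h4 h5
  have bd : b ≠ d := by rintro rfl; exact no_triangle G hg h4 h5 h1
  have ce : c ≠ e := by rintro rfl; exact no_triangle G hg h5 h1 h2
  have da : d ≠ a := by rintro rfl; exact no_triangle G hg h1 h2 h3
  have eb : e ≠ b := by rintro rfl; exact no_triangle G hg h2 h3 h4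
  obtain ⟨x, hx, hxs⟩ := hb a (.cons h1 (.cons h2 (.cons h3 (.cons h4 (.cons h5 .nil))))) (by
    simp [SimpleGraph.Walk.isCycle_def, SimpleGraph.Walk.isTrail_def, h1.ne, h2.ne, h3.ne, h4.ne, h5.ne, h1.ne', h2.ne', h3.ne', h4.ne', h5.ne', ac, ac.symm, bd, bd.symm, ce, ce.symm, da, da.symm, eb, eb.symm]) (by simp)
  simp at hxs
  rcases hxs with rfl | rfl | rfl | rfl | rfl | rfl <;> simp [hx]

/-- The edge set of a pentagon. -/
def pentEdges [DecidableEq V] (a b c d e : V) : Finset (Sym2 V) :=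
  {s(a, b), s(b, c), s(c, d), s(d, e), s(e, a)}

/-- Every short cycle is a pentagon. -/
lemma short_is_pent [DecidableEq V] (G : SimpleGraph V) (hg : 5 ≤ G.egirth) {u : V} (w : G.Walk u u)
    (hw : w.IsCycle) (hl : w.length ≤ 5) :
    ∃ b c d e : V, G.Adj u b ∧ G.Adj b c ∧ G.Adj c d ∧ G.Adj d e ∧ G.Adj e u ∧
      w.edges.toFinset = pentEdges u b c d e ∧ w.support = [u, b, c, d, e, u] := by
  have h5 : w.length = 5 := by
    have := SimpleGraph.le_egirth.1 hg _ w hw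
    have : 5 ≤ w.length := by exact_mod_cast this
    omega
  match w, h5 with
  | .cons (v := b) h1 (.cons (v := c) h2 (.cons (v := d) h3 (.cons (v := e) h4 (.cons h5 .nil)))), _ =>
    exact ⟨b, c, d, e, h1, h2, h3, h4, h5, by simp [pentEdges], by simp⟩

/-- The third neighbour of a vertex of a cubic graph. -/
lemma third_nbr [Fintype V] [DecidableEq V] (G : SimpleGraph V) [DecidableRel G.Adj]
    (hcubic : G.IsRegularOfDegree 3) {v a b : V} (ha : G.Adj v a) (hb : G.Adj v b) (hab : a ≠ b) :
    ∃ c, G.Adj v c ∧ c ≠ a ∧ c ≠ b ∧ ∀ y, G.Adj v y → y = a ∨ y = b ∨ y = c := by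
  have h := hcubic v
  rw [← SimpleGraph.card_neighborFinset_eq_degree] at h
  have hs : {a, b} ⊆ G.neighborFinset v := by
    intro x hx
    simp at hx
    rcases hx with rfl | rfl <;> simpa
  have h2 : (G.neighborFinset v \ {a, b}).card = 1 := by
    rw [Finset.card_sdiff_of_subset hs, h, Finset.card_pair hab]
  obtain ⟨c, hc⟩ := Finset.card_eq_one.1 h2
  have hmem : ∀ y, y ∈ G.neighborFinset v \ {a, b} ↔ y = c := by simp [hc]
  simp only [Finset.mem_sdiff, SimpleGraph.mem_neighborFinset, Finset.mem_insert,
    Finset.mem_singleton, not_or] at hmem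
  have hcc := (hmem c).2 rfl
  refine ⟨c, hcc.1, hcc.2.1, hcc.2.2, fun y hy => ?_⟩
  have := hmem y
  tauto

lemma nbr_of_three [Fintype V] [DecidableEq V] (G : SimpleGraph V) [DecidableRel G.Adj]
    (hcubic : G.IsRegularOfDegree 3) {v a b c : V} (ha : G.Adj v a) (hb : G.Adj v b)
    (hc : G.Adj v c) (hab : a ≠ b) (hac : a ≠ c) (hbc : b ≠ c) :
    ∀ y, G.Adj v y → y = a ∨ y = b ∨ y = c := by
  obtain ⟨c', -, -, -, h⟩ := third_nbr G hcubic ha hb hab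
  rcases h c hc with h' | h' | h'
  · exact absurd h'.symm hac
  · exact absurd h'.symm hbc
  · subst h'; exact h

end helpers

section conf
variable {V : Type*}

lemma cut_le [DecidableEq V] (G : SimpleGraph V) (X : Set V) (F : Finset (Sym2 V))
    (h : ∀ x ∈ X, ∀ y, y ∉ X → G.Adj x y → s(x, y) ∈ F) : (cut G X).ncard ≤ F.card := by
  rw [← Set.ncard_coe_finset]
  refine Set.ncard_le_ncard ?_ (Finset.finite_toSet _)
  rintro e ⟨he, x, hx, y, hy, rfl⟩
  exact h x hx y hy he

/-- A pentagon `c` together with the third neighbours `d` of its vertices. -/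
structure Conf (G : SimpleGraph V) (c d : Fin 5 → V) : Prop where
  cc : ∀ i, G.Adj (c i) (c (i + 1))
  cd : ∀ i, G.Adj (c i) (d i)
  cn : ∀ i y, G.Adj (c i) y → y = c (i + 1) ∨ y = c (i + 4) ∨ y = d i
  cinj : Function.Injective c
  dinj : Function.Injective d
  cne : ∀ i j, c i ≠ d j

lemma Conf.rot {G : SimpleGraph V} {c d : Fin 5 → V} (h : Conf G c d) (k : Fin 5) :
    Conf G (fun i => c (i + k)) (fun i => d (i + k)) where
  cc i := by
    have := h.cc (i + k)
    rwa [add_right_comm] at this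
  cd i := h.cd (i + k)
  cn i y hy := by
    have := h.cn (i + k) y hy
    rwa [add_right_comm, add_right_comm i k 4] at this
  cinj := h.cinj.comp (add_left_injective k)
  dinj := h.dinj.comp (add_left_injective k)
  cne i j := h.cne _ _

lemma fin5_cases : ∀ i j : Fin 5, i ≠ j → j = i + 1 ∨ j = i + 2 ∨ i = j + 1 ∨ i = j + 2 := by
  decide

lemma fin5_injective (c : Fin 5 → V) (h1 : ∀ i, c i ≠ c (i + 1))
    (h2 : ∀ i, c i ≠ c (i + 2)) : Function.Injective c := by
  intro i j hij
  by_contra hne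
  rcases fin5_cases i j hne with rfl | rfl | rfl | rfl
  · exact h1 _ hij
  · exact h2 _ hij
  · exact h1 _ hij.symm
  · exact h2 _ hij.symm

variable [Fintype V] [DecidableEq V] (G : SimpleGraph V) [DecidableRel G.Adj]

lemma exists_conf (hcubic : G.IsRegularOfDegree 3) (hg : 5 ≤ G.egirth) (c : Fin 5 → V)
    (cc : ∀ i, G.Adj (c i) (c (i + 1))) : ∃ d, Conf G c d := by
  have c2 : ∀ i, G.Adj (c (i + 1)) (c (i + 2)) := fun i => by
    have := cc (i + 1); rwa [add_assoc] at this
  have c4 : ∀ i, G.Adj (c i) (c (i + 4)) := fun i => by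
    have := cc (i + 4); rw [add_assoc] at this; simpa using this.symm
  have n2 : ∀ i, ¬ G.Adj (c i) (c (i + 2)) := fun i h =>
    no_triangle G hg (cc i) (c2 i) h.symm
  have ne2 : ∀ i, c i ≠ c (i + 2) := fun i h => by
    have h3 : G.Adj (c (i + 2)) (c (i + 3)) := by
      have := cc (i + 2); rwa [add_assoc] at this
    have h4 : G.Adj (c (i + 3)) (c (i + 4)) := by
      have := cc (i + 3); rwa [add_assoc] at this
    rw [← h] at h3
    exact no_triangle G hg h3 h4 (c4 i).symm
  have cinj : Function.Injective c := fin5_injective c (fun i => (cc i).ne) ne2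
  have h : ∀ i, ∃ e, G.Adj (c i) e ∧ e ≠ c (i + 1) ∧ e ≠ c (i + 4) ∧
      ∀ y, G.Adj (c i) y → y = c (i + 1) ∨ y = c (i + 4) ∨ y = e := fun i =>
    third_nbr G hcubic (cc i) (c4 i) (fun h => absurd (cinj h) ((by decide : ∀ i : Fin 5, i + 1 ≠ i + 4) i))
  choose d h1 h2 h3 h4 using h
  have cne : ∀ i j, c i ≠ d j := by
    intro i j h
    have hj := h1 j
    rw [← h] at hj
    rcases eq_or_ne i j with rfl | hij
    · exact hj.ne rfl
    rcases fin5_cases i j hij with rfl | rfl | rfl | rfl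
    · apply h3 (i + 1); rw [← h, add_assoc]; simp
    · exact n2 _ hj.symm
    · exact h2 _ h.symm
    · exact n2 _ hj
  refine ⟨d, cc, h1, h4, cinj, ?_, cne⟩
  refine fin5_injective d (fun i h => ?_) (fun i h => ?_)
  · have := h1 (i + 1)
    rw [← h] at this
    exact no_triangle G hg (cc i) this (h1 i).symm
  · have := h1 (i + 2)
    rw [← h] at this
    exact no_square G hg (cc i) (c2 i) this (h1 i).symm (ne2 i) (cne _ _)

variable {G} {c d : Fin 5 → V}

lemma Conf.no_dd2 (h : Conf G c d) (hcubic : G.IsRegularOfDegree 3)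
    (htheta : ∀ X : Finset V, 7 ≤ X.card → X.card + 7 ≤ Fintype.card V →
      6 ≤ (cut G (X : Set V)).ncard)
    (hcard : 14 ≤ Fintype.card V) (i : Fin 5) : ¬ G.Adj (d i) (d (i + 2)) := by
  suffices H : ∀ c d : Fin 5 → V, Conf G c d → ¬ G.Adj (d 0) (d 2) by
    have := H _ _ (h.rot i)
    simpa [add_comm] using this
  clear h
  intro c d h hadj
  obtain ⟨e0, -, -, -, he0⟩ := third_nbr G hcubic (h.cd 0).symm hadj (h.cne _ _)
  obtain ⟨e2, -, -, -, he2⟩ := third_nbr G hcubic (h.cd 2).symm hadj.symm (h.cne _ _)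
  have hX : (Finset.univ.image c ∪ {d 0, d 2}).card = 7 := by
    rw [Finset.card_union_of_disjoint, Finset.card_image_of_injective _ h.cinj,
      Finset.card_pair hadj.ne]
    · rfl
    · rw [Finset.disjoint_left]
      intro v hv hv'
      simp only [Finset.mem_image, Finset.mem_univ, true_and, Finset.mem_insert,
        Finset.mem_singleton] at hv hv'
      obtain ⟨j, rfl⟩ := hv
      rcases hv' with h' | h' <;> exact h.cne _ _ h'
  have h1 := htheta (Finset.univ.image c ∪ {d 0, d 2}) (by omega) (by omega)
  have h2 := cut_le G ((Finset.univ.image c ∪ {d 0, d 2} : Finset V) : Set V)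
    {s(c 1, d 1), s(c 3, d 3), s(c 4, d 4), s(d 0, e0), s(d 2, e2)} (by
      intro x hx y hy hxy
      simp only [Finset.coe_union, Set.mem_union, Finset.mem_coe, Finset.mem_image,
        Finset.mem_univ, true_and, Finset.mem_insert, Finset.mem_singleton, not_or,
        not_exists] at hx hy
      rcases hx with ⟨j, rfl⟩ | rfl | rfl
      · rcases h.cn j y hxy with rfl | rfl | rfl
        · exact absurd rfl (hy.1 _)
        · exact absurd rfl (hy.1 _)
        · fin_cases j <;> simp_all
      · rcases he0 y hxy with rfl | rfl | rfl
        · exact absurd rfl (hy.1 _)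
        · exact absurd rfl hy.2.2
        · simp
      · rcases he2 y hxy with rfl | rfl | rfl
        · exact absurd rfl (hy.1 _)
        · exact absurd rfl hy.2.1
        · simp)
  have h3 := h2.trans Finset.card_le_five
  omega

/-- The vertices outside a pentagon adjacent to it are pairwise nonadjacent. -/
lemma Conf.no_dd (h : Conf G c d) (hcubic : G.IsRegularOfDegree 3) (hg : 5 ≤ G.egirth)
    (htheta : ∀ X : Finset V, 7 ≤ X.card → X.card + 7 ≤ Fintype.card V →
      6 ≤ (cut G (X : Set V)).ncard)
    (hcard : 14 ≤ Fintype.card V) (i j : Fin 5) : ¬ G.Adj (d i) (d j) := by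
  have h1 : ∀ i, ¬ G.Adj (d i) (d (i + 1)) := fun i hi =>
    no_square G hg (h.cc i) (h.cd (i + 1)) hi.symm (h.cd i).symm (h.cne _ _) (h.cne _ _)
  have h2 := h.no_dd2 hcubic htheta hcard
  intro hij
  rcases fin5_cases i j (fun e => by subst e; exact hij.ne rfl) with rfl | rfl | rfl | rfl
  · exact h1 _ hij
  · exact h2 _ hij
  · exact h1 _ hij.symm
  · exact h2 _ hij.symm

lemma card_even (hcubic : G.IsRegularOfDegree 3) : Even (Fintype.card V) := by
  have h := G.sum_degrees_eq_twice_card_edges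
  simp only [hcubic.degree_eq, Finset.sum_const, Finset.card_univ, smul_eq_mul] at h
  rw [Nat.even_iff]
  omega

/-- No vertex is adjacent to three consecutive `d`s. -/
lemma Conf.no_three (h : Conf G c d) (hcubic : G.IsRegularOfDegree 3)
    (htheta : ∀ X : Finset V, 7 ≤ X.card → X.card + 7 ≤ Fintype.card V →
      6 ≤ (cut G (X : Set V)).ncard)
    (hcard : 14 ≤ Fintype.card V)
    (hb : ∀ (v : V) (c' : G.Walk v v), c'.IsCycle → c'.length ≤ 5 →
      ∃ x, x ∈ Set.range c ∧ x ∈ c'.support) (i : Fin 5) (x : V)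
    (hx0 : G.Adj x (d i)) (hx1 : G.Adj x (d (i + 1))) (hx2 : G.Adj x (d (i + 2))) : False := by
  suffices H : ∀ c d : Fin 5 → V, Conf G c d →
      (∀ (v : V) (c' : G.Walk v v), c'.IsCycle → c'.length ≤ 5 →
        ∃ x, x ∈ Set.range c ∧ x ∈ c'.support) →
      G.Adj x (d 0) → G.Adj x (d 1) → G.Adj x (d 2) → False by
    refine H _ _ (h.rot i) ?_ (by simpa using hx0) (by simpa [add_comm] using hx1)
      (by simpa [add_comm] using hx2)
    intro v c' h1 h2
    obtain ⟨y, ⟨j, rfl⟩, hy⟩ := hb v c' h1 h2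
    exact ⟨_, ⟨j - i, by simp⟩, hy⟩
  clear h hb hx0 hx1 hx2
  intro c d h hb hx0 hx1 hx2
  have xc : ∀ j, c j ≠ x := by
    rintro j rfl
    have h0 : (0 : Fin 5) = j := by
      rcases h.cn j _ hx0 with h' | h' | h'
      · exact absurd h'.symm (h.cne _ _)
      · exact absurd h'.symm (h.cne _ _)
      · exact h.dinj h'
    have h1 : (1 : Fin 5) = j := by
      rcases h.cn j _ hx1 with h' | h' | h'
      · exact absurd h'.symm (h.cne _ _)
      · exact absurd h'.symm (h.cne _ _)
      · exact h.dinj h'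
    exact absurd (h0.trans h1.symm) (by decide)
  have d01 : d 0 ≠ d 1 := fun e => absurd (h.dinj e) (by decide)
  have d02 : d 0 ≠ d 2 := fun e => absurd (h.dinj e) (by decide)
  have d12 : d 1 ≠ d 2 := fun e => absurd (h.dinj e) (by decide)
  obtain ⟨e0, -, -, -, he0⟩ := third_nbr G hcubic (h.cd 0).symm hx0.symm (xc _)
  obtain ⟨e1, -, -, -, he1⟩ := third_nbr G hcubic (h.cd 1).symm hx1.symm (xc _)
  obtain ⟨e2, -, -, -, he2⟩ := third_nbr G hcubic (h.cd 2).symm hx2.symm (xc _)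
  have hxn := nbr_of_three G hcubic hx0 hx1 hx2 d01 d02 d12
  have hX : (Finset.univ.image c ∪ {d 0, d 1, d 2, x}).card = 9 := by
    rw [Finset.card_union_of_disjoint, Finset.card_image_of_injective _ h.cinj]
    · have : ({d 0, d 1, d 2, x} : Finset V).card = 4 := by
        rw [Finset.card_eq_succ]
        refine ⟨d 0, {d 1, d 2, x}, ?_, rfl, ?_⟩
        · simp [d01, d02, hx0.ne']
        · exact Finset.card_eq_three.2 ⟨_, _, _, d12, hx1.ne', hx2.ne', rfl⟩
      rw [this]; rfl
    · rw [Finset.disjoint_left]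
      intro v hv hv'
      simp only [Finset.mem_image, Finset.mem_univ, true_and, Finset.mem_insert,
        Finset.mem_singleton] at hv hv'
      obtain ⟨j, rfl⟩ := hv
      rcases hv' with h' | h' | h' | h'
      · exact h.cne _ _ h'
      · exact h.cne _ _ h'
      · exact h.cne _ _ h'
      · exact xc _ h'
  have h2 := cut_le G ((Finset.univ.image c ∪ {d 0, d 1, d 2, x} : Finset V) : Set V)
    {s(c 3, d 3), s(c 4, d 4), s(d 0, e0), s(d 1, e1), s(d 2, e2)} (by
      intro z hz y hy hxy
      simp only [Finset.coe_union, Set.mem_union, Finset.mem_coe, Finset.mem_image,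
        Finset.mem_univ, true_and, Finset.mem_insert, Finset.mem_singleton, not_or,
        not_exists] at hz hy
      obtain ⟨hyc, hy0, hy1, hy2, hyx⟩ := hy
      rcases hz with ⟨j, rfl⟩ | rfl | rfl | rfl | rfl
      · rcases h.cn j y hxy with rfl | rfl | rfl
        · exact absurd rfl (hyc _)
        · exact absurd rfl (hyc _)
        · fin_cases j <;> simp_all
      · rcases he0 y hxy with rfl | rfl | rfl
        · exact absurd rfl (hyc _)
        · exact absurd rfl hyx
        · simp
      · rcases he1 y hxy with rfl | rfl | rfl
        · exact absurd rfl (hyc _)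
        · exact absurd rfl hyx
        · simp
      · rcases he2 y hxy with rfl | rfl | rfl
        · exact absurd rfl (hyc _)
        · exact absurd rfl hyx
        · simp
      · rcases hxn y hxy with rfl | rfl | rfl
        · exact absurd rfl hy0
        · exact absurd rfl hy1
        · exact absurd rfl hy2)
  have h3 := h2.trans Finset.card_le_five
  have hev := card_even hcubic
  rw [Nat.even_iff] at hev
  by_cases hn : 16 ≤ Fintype.card V
  · have := htheta _ (by omega : 7 ≤ (Finset.univ.image c ∪ {d 0, d 1, d 2, x}).card) (by omega)
    omega
  · have hYc := Finset.card_compl (Finset.univ.image c ∪ {d 0, d 1, d 2, x})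
    have := cut_of_avoid G hcubic (Set.range c) hb (Finset.univ.image c ∪ {d 0, d 1, d 2, x})ᶜ
      (by rw [← Finset.card_pos]; omega)
      (by rintro _ ⟨j, rfl⟩; simp) (by omega)
    rw [Finset.coe_compl, cut_compl] at this
    omega

/-- A pentagon through `c 0`, `c 1`. -/
lemma Conf.classify (h : Conf G c d) (hcubic : G.IsRegularOfDegree 3) (hg : 5 ≤ G.egirth)
    (htheta : ∀ X : Finset V, 7 ≤ X.card → X.card + 7 ≤ Fintype.card V →
      6 ≤ (cut G (X : Set V)).ncard)
    (hcard : 14 ≤ Fintype.card V) (i : Fin 5) {p2 p3 p4 : V}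
    (h1 : G.Adj (c (i + 1)) p2) (h2 : G.Adj p2 p3) (h3 : G.Adj p3 p4) (h4 : G.Adj p4 (c i)) :
    (p2 = c (i + 2) ∧ p3 = c (i + 3) ∧ p4 = c (i + 4)) ∨ (p2 = d (i + 1) ∧ p4 = d i) := by
  suffices H : ∀ c d : Fin 5 → V, Conf G c d → G.Adj (c 1) p2 → G.Adj p4 (c 0) →
      (p2 = c 2 ∧ p3 = c 3 ∧ p4 = c 4) ∨ (p2 = d 1 ∧ p4 = d 0) by
    have := H _ _ (h.rot i) (by simpa [add_comm] using h1) (by simpa using h4)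
    simpa [add_comm] using this
  clear h h1 h4
  intro c d h h1 h4
  have hdd := h.no_dd hcubic hg htheta hcard
  have hcd : ∀ i j, G.Adj (c i) (d j) → j = i := by
    intro i j hij
    rcases h.cn i _ hij with h' | h' | h'
    · exact absurd h'.symm (h.cne _ _)
    · exact absurd h'.symm (h.cne _ _)
    · exact h.dinj h'
  have h01 := h.cc 0
  have n20 : p2 ≠ c 0 := by rintro rfl; exact no_triangle G hg h2 h3 h4
  have n41 : p4 ≠ c 1 := by rintro rfl; exact no_triangle G hg h1 h2 h3
  have n31 : p3 ≠ c 1 := by rintro rfl; exact no_triangle G hg h3 h4 h01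
  have n30 : p3 ≠ c 0 := by rintro rfl; exact no_triangle G hg h01 h1 h2
  rcases h.cn 1 _ h1 with e2 | e2 | e2
  · change p2 = c 2 at e2
    subst e2
    rcases h.cn 0 _ h4.symm with e4 | e4 | e4
    · exact absurd e4 n41
    · change p4 = c 4 at e4
      subst e4
      rcases h.cn 2 _ h2 with e3 | e3 | e3
      · exact Or.inl ⟨rfl, e3, rfl⟩
      · exact absurd e3 n31
      · subst e3
        exact absurd (hcd _ _ h3.symm) (by decide)
    · subst e4
      rcases h.cn 2 _ h2 with e3 | e3 | e3
      · subst e3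
        exact absurd (hcd _ _ h3) (by decide)
      · exact absurd e3 n31
      · subst e3
        exact absurd h3 (hdd _ _)
  · exact absurd e2 n20
  · subst e2
    rcases h.cn 0 _ h4.symm with e4 | e4 | e4
    · exact absurd e4 n41
    · change p4 = c 4 at e4
      subst e4
      rcases h.cn 4 _ h3.symm with e3 | e3 | e3
      · exact absurd e3 n30
      · subst e3
        exact absurd (hcd _ _ h2.symm) (by decide)
      · subst e3
        exact absurd h2 (hdd _ _)
    · exact Or.inr ⟨rfl, e4⟩

end conf

section final
variable {V : Type*} [Fintype V] [DecidableEq V] {G : SimpleGraph V} [DecidableRel G.Adj]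
  {c d : Fin 5 → V}

/-- The five pentagons adjacent to the breaker are not all present. -/
lemma Conf.not_all (h : Conf G c d) (hcubic : G.IsRegularOfDegree 3) (hg : 5 ≤ G.egirth)
    (htheta : ∀ X : Finset V, 7 ≤ X.card → X.card + 7 ≤ Fintype.card V →
      6 ≤ (cut G (X : Set V)).ncard)
    (hcard : 14 ≤ Fintype.card V)
    (hb : ∀ (v : V) (c' : G.Walk v v), c'.IsCycle → c'.length ≤ 5 →
      ∃ x, x ∈ Set.range c ∧ x ∈ c'.support)
    (x : Fin 5 → V) (hx : ∀ i, G.Adj (d i) (x i)) (hx' : ∀ i, G.Adj (x i) (d (i + 1))) :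
    False := by
  have a2 : ∀ i : Fin 5, i + 1 + 1 = i + 2 := by decide
  have a3 : ∀ i : Fin 5, i + 2 + 1 = i + 3 := by decide
  have hdd := h.no_dd hcubic hg htheta hcard
  have h3 := h.no_three hcubic htheta hcard hb
  have x1' : ∀ i, G.Adj (x (i + 1)) (d (i + 2)) := fun i => by
    have := hx' (i + 1); rwa [a2] at this
  have ne1 : ∀ i, x i ≠ x (i + 1) := fun i e =>
    h3 i (x i) (hx i).symm (hx' i) (by rw [e]; exact x1' i)
  have ne2 : ∀ i, x i ≠ x (i + 2) := fun i e =>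
    h3 i (x i) (hx i).symm (hx' i) (by rw [e]; exact (hx (i + 2)).symm)
  have xinj : Function.Injective x := fin5_injective x ne1 ne2
  have dne : ∀ i, d i ≠ d (i + 1) := fun i e =>
    absurd (h.dinj e) ((by decide : ∀ i : Fin 5, i ≠ i + 1) i)
  have hcd : ∀ i j, G.Adj (c i) (d j) → j = i := by
    intro i j hij
    rcases h.cn i _ hij with h' | h' | h'
    · exact absurd h'.symm (h.cne _ _)
    · exact absurd h'.symm (h.cne _ _)
    · exact h.dinj h'
  have cx : ∀ i j, c i ≠ x j := by
    intro i j e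
    have e1 := hx' j
    have e2 := (hx j).symm
    rw [← e] at e1 e2
    have := hcd _ _ e1
    have := hcd _ _ e2
    exact dne j (by congr 1; omega)
  have dx : ∀ i j, d i ≠ x j := by
    intro i j e
    have e2 := hx j
    rw [← e] at e2
    exact hdd _ _ e2
  have dn : ∀ i v, G.Adj (d (i + 1)) v → v = c (i + 1) ∨ v = x i ∨ v = x (i + 1) := fun i =>
    nbr_of_three G hcubic (h.cd (i + 1)).symm (hx' i).symm (hx (i + 1)) (cx _ _) (cx _ _) (ne1 i)
  have xx1 : ∀ i, ¬ G.Adj (x i) (x (i + 1)) := fun i hi =>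
    no_triangle G hg hi (hx (i + 1)).symm (hx' i).symm
  have xx2 : ∀ i, ¬ G.Adj (x i) (x (i + 2)) := fun i hi => by
    rcases pent_meets G hg _ hb (hx' i) (hx (i + 1)) (x1' i) (hx (i + 2)) hi.symm with
      ⟨j, hj⟩ | ⟨j, hj⟩ | ⟨j, hj⟩ | ⟨j, hj⟩ | ⟨j, hj⟩
    · exact cx _ _ hj
    · exact h.cne _ _ hj
    · exact cx _ _ hj
    · exact h.cne _ _ hj
    · exact cx _ _ hj
  have xx : ∀ i j, ¬ G.Adj (x i) (x j) := by
    intro i j hij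
    rcases fin5_cases i j (fun e => by subst e; exact hij.ne rfl) with rfl | rfl | rfl | rfl
    · exact xx1 _ hij
    · exact xx2 _ hij
    · exact xx1 _ hij.symm
    · exact xx2 _ hij.symm
  have hy : ∀ i, ∃ e, G.Adj (x i) e ∧ e ≠ d i ∧ e ≠ d (i + 1) ∧
      ∀ v, G.Adj (x i) v → v = d i ∨ v = d (i + 1) ∨ v = e := fun i =>
    third_nbr G hcubic (hx i).symm (hx' i) (dne i)
  choose y y1 y2 y3 y4 using hy
  have yc : ∀ i j, c j ≠ y i := by
    intro i j e
    have := (y1 i).symm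
    rw [← e] at this
    rcases h.cn j _ this with h' | h' | h'
    · exact cx _ _ h'.symm
    · exact cx _ _ h'.symm
    · exact dx _ _ h'.symm
  have yx : ∀ i j, x j ≠ y i := by
    intro i j e
    have := y1 i
    rw [← e] at this
    exact xx _ _ this
  have yd : ∀ i j, d j ≠ y i := by
    intro i j e
    have e1 := (y1 i).symm
    obtain ⟨j, rfl⟩ : ∃ k, j = k + 1 := ⟨j - 1, by simp⟩
    rw [← e] at e1
    rcases dn _ _ e1 with h' | h' | h'
    · exact cx _ _ h'.symm
    · have := xinj h'
      subst this
      exact y3 _ e.symm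
    · have := xinj h'
      subst this
      exact y2 _ e.symm
  have yne : ∀ i, y i ≠ y (i + 1) := by
    intro i e
    have e1 := y1 (i + 1)
    rw [← e] at e1
    exact no_square G hg (hx' i) (hx (i + 1)) e1 (y1 i).symm (ne1 i) (yd _ _)
  have yadj : ∀ i, ¬ G.Adj (y i) (y (i + 1)) := by
    intro i hi
    rcases pent_meets G hg _ hb hi (y1 (i + 1)).symm (hx (i + 1)).symm (hx' i).symm (y1 i) with
      ⟨j, hj⟩ | ⟨j, hj⟩ | ⟨j, hj⟩ | ⟨j, hj⟩ | ⟨j, hj⟩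
    · exact yc _ _ hj
    · exact yc _ _ hj
    · exact cx _ _ hj
    · exact h.cne _ _ hj
    · exact cx _ _ hj
  obtain ⟨X, hXdef⟩ : ∃ X : Finset V,
      X = (Finset.univ.image c ∪ Finset.univ.image d) ∪ Finset.univ.image x := ⟨_, rfl⟩
  have hXm : ∀ v, v ∈ X ↔ (∃ i, c i = v) ∨ (∃ i, d i = v) ∨ (∃ i, x i = v) := by
    intro v; simp [hXdef, or_assoc]
  have hXc : X.card = 15 := by
    rw [hXdef, Finset.card_union_of_disjoint, Finset.card_union_of_disjoint,
      Finset.card_image_of_injective _ h.cinj, Finset.card_image_of_injective _ h.dinj,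
      Finset.card_image_of_injective _ xinj]
    · rfl
    · rw [Finset.disjoint_left]
      intro v hv hv'
      simp only [Finset.mem_image, Finset.mem_univ, true_and] at hv hv'
      obtain ⟨i, rfl⟩ := hv
      obtain ⟨j, hj⟩ := hv'
      exact h.cne _ _ hj.symm
    · rw [Finset.disjoint_left]
      intro v hv hv'
      simp only [Finset.mem_union, Finset.mem_image, Finset.mem_univ, true_and] at hv hv'
      obtain ⟨j, hj⟩ := hv'
      rcases hv with ⟨i, rfl⟩ | ⟨i, rfl⟩
      · exact cx _ _ hj.symm
      · exact dx _ _ hj.symm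
  -- every edge leaving `X` is one of the `x i - y i`
  have hout : ∀ z ∈ X, ∀ v, v ∉ X → G.Adj z v → ∃ i, z = x i ∧ v = y i := by
    intro z hz v hv hzv
    rw [hXm] at hz hv
    push Not at hv
    obtain ⟨hvc, hvd, hvx⟩ := hv
    rcases hz with ⟨i, rfl⟩ | ⟨i, rfl⟩ | ⟨i, rfl⟩
    · rcases h.cn i v hzv with h' | h' | h'
      · exact absurd h'.symm (hvc _)
      · exact absurd h'.symm (hvc _)
      · exact absurd h'.symm (hvd _)
    · obtain ⟨j, rfl⟩ : ∃ k, i = k + 1 := ⟨i - 1, by simp⟩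
      rcases dn _ v hzv with h' | h' | h'
      · exact absurd h'.symm (hvc _)
      · exact absurd h'.symm (hvx _)
      · exact absurd h'.symm (hvx _)
    · rcases y4 _ v hzv with h' | h' | h'
      · exact absurd h'.symm (hvd _)
      · exact absurd h'.symm (hvd _)
      · exact ⟨i, rfl, h'⟩
  have hcut : (cut G (X : Set V)).ncard ≤ 5 := by
    refine (cut_le G _ (Finset.univ.image fun i => s(x i, y i)) ?_).trans
      (Finset.card_image_le.trans (by simp))
    intro z hz v hv hzv
    obtain ⟨i, rfl, rfl⟩ := hout z (by simpa using hz) v (by simpa using hv) hzv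
    exact Finset.mem_image_of_mem (fun i => s(x i, y i)) (Finset.mem_univ i)
  have yX : ∀ i, y i ∈ Xᶜ := by
    intro i
    rw [Finset.mem_compl, hXm]
    push Not
    exact ⟨fun j => yc _ _, fun j => yd _ _, fun j => yx _ _⟩
  have hev := card_even hcubic
  rw [Nat.even_iff] at hev
  have hYc := Finset.card_compl X
  have hle : X.card ≤ Fintype.card V := Finset.card_le_univ X
  by_cases hn : 22 ≤ Fintype.card V
  · have := htheta X (by omega) (by omega)
    omega
  have h5 := cut_of_avoid G hcubic (Set.range c) hb Xᶜ ⟨_, yX 0⟩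
      (by rintro _ ⟨j, rfl⟩; rw [Finset.mem_compl, not_not, hXm]; exact Or.inl ⟨j, rfl⟩) (by omega)
  rw [Finset.coe_compl, cut_compl] at h5
  have hY3 : Xᶜ.card ≤ 3 := by omega
  obtain ⟨i, hi⟩ : ∃ i, y i ≠ y (i + 2) := by
    by_contra hall
    push Not at hall
    have e0 := hall 0
    have e2 := hall 2
    have e4 := hall 4
    have := yne 0
    exact this (e0.trans (e2.trans e4))
  have y12 : y (i + 1) ≠ y (i + 2) := by
    have := yne (i + 1); rwa [a2] at this
  have hset : ({y i, y (i + 1), y (i + 2)} : Finset V) = Xᶜ := by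
    refine Finset.eq_of_subset_of_card_le ?_ ?_
    · intro v hv
      simp only [Finset.mem_insert, Finset.mem_singleton] at hv
      rcases hv with rfl | rfl | rfl <;> exact yX _
    · rw [Finset.card_eq_three.2 ⟨_, _, _, yne i, hi, y12, rfl⟩]
      exact hY3
  have hnb : ∀ v, G.Adj (y (i + 1)) v → ∃ j, v = x j ∧ y (i + 1) = y j := by
    intro v hv
    by_cases hvX : v ∈ X
    · exact hout v hvX _ (by simpa using yX (i + 1)) hv.symm
    · exfalso
      rw [← Finset.mem_compl, ← hset] at hvX
      simp only [Finset.mem_insert, Finset.mem_singleton] at hvX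
      rcases hvX with rfl | rfl | rfl
      · exact yadj _ hv.symm
      · exact hv.ne rfl
      · have := yadj (i + 1)
        rw [a2] at this
        exact this hv
  have hdeg := hcubic (y (i + 1))
  rw [← SimpleGraph.card_neighborFinset_eq_degree] at hdeg
  have hsub : G.neighborFinset (y (i + 1)) ⊆
      (Finset.univ.filter fun j => y (i + 1) = y j).image x := by
    intro v hv
    rw [SimpleGraph.mem_neighborFinset] at hv
    obtain ⟨j, rfl, hj⟩ := hnb v hv
    exact Finset.mem_image_of_mem _ (by simpa using hj)
  have hc1 := (Finset.card_le_card hsub).trans Finset.card_image_le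
  have hj : ∀ i j : Fin 5, j = i ∨ j = i + 1 ∨ j = i + 2 ∨ j = i + 3 ∨ j = i + 4 := by decide
  have y34 : y (i + 3) ≠ y (i + 4) := by
    have := yne (i + 3)
    rwa [(by decide : ∀ i : Fin 5, i + 3 + 1 = i + 4) i] at this
  have hc2 : (Finset.univ.filter fun j => y (i + 1) = y j).card ≤ 2 := by
    by_cases h34 : y (i + 1) = y (i + 3)
    · refine (Finset.card_le_card (?_ : _ ⊆ ({i + 1, i + 3} : Finset (Fin 5)))).trans
        Finset.card_le_two
      intro j hjm
      simp only [Finset.mem_filter, Finset.mem_univ, true_and] at hjm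
      simp only [Finset.mem_insert, Finset.mem_singleton]
      rcases hj i j with rfl | rfl | rfl | rfl | rfl
      · exact absurd hjm.symm (yne _)
      · exact Or.inl rfl
      · exact absurd hjm y12
      · exact Or.inr rfl
      · exact absurd (h34.symm.trans hjm) y34
    · refine (Finset.card_le_card (?_ : _ ⊆ ({i + 1, i + 4} : Finset (Fin 5)))).trans
        Finset.card_le_two
      intro j hjm
      simp only [Finset.mem_filter, Finset.mem_univ, true_and] at hjm
      simp only [Finset.mem_insert, Finset.mem_singleton]
      rcases hj i j with rfl | rfl | rfl | rfl | rfl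
      · exact absurd hjm.symm (yne _)
      · exact Or.inl rfl
      · exact absurd hjm y12
      · exact absurd hjm h34
      · exact Or.inr rfl
  omega

/-- Every short cycle is the breaker or shares exactly one edge with it. -/
lemma Conf.short (h : Conf G c d) (hcubic : G.IsRegularOfDegree 3) (hg : 5 ≤ G.egirth)
    (htheta : ∀ X : Finset V, 7 ≤ X.card → X.card + 7 ≤ Fintype.card V →
      6 ≤ (cut G (X : Set V)).ncard)
    (hcard : 14 ≤ Fintype.card V)
    (hb : ∀ (v : V) (c' : G.Walk v v), c'.IsCycle → c'.length ≤ 5 →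
      ∃ x, x ∈ Set.range c ∧ x ∈ c'.support)
    {p0 p1 p2 p3 p4 : V} (h0 : G.Adj p0 p1) (h1 : G.Adj p1 p2) (h2 : G.Adj p2 p3)
    (h3 : G.Adj p3 p4) (h4 : G.Adj p4 p0) :
    pentEdges p0 p1 p2 p3 p4 = pentEdges (c 0) (c 1) (c 2) (c 3) (c 4) ∨
    ∃ i x, G.Adj (d i) x ∧ G.Adj x (d (i + 1)) ∧
      pentEdges p0 p1 p2 p3 p4 = pentEdges (c i) (c (i + 1)) (d (i + 1)) x (d i) := by
  have rot : ∀ a b c d e : V, pentEdges a b c d e = pentEdges b c d e a := by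
    intro a b c d e
    ext z; simp only [pentEdges, Finset.mem_insert, Finset.mem_singleton]; tauto
  have rev : ∀ a b c d e : V, pentEdges a b c d e = pentEdges a e d c b := by
    intro a b c d e
    ext z
    simp only [pentEdges, Finset.mem_insert, Finset.mem_singleton, Sym2.eq_swap (a := b) (b := a),
      Sym2.eq_swap (a := c) (b := b), Sym2.eq_swap (a := d) (b := c),
      Sym2.eq_swap (a := e) (b := d), Sym2.eq_swap (a := a) (b := e)]
    tauto
  -- the case where `p0 p1` is an edge of the breaker
  have key : ∀ (i : Fin 5) (p2 p3 p4 : V), G.Adj (c (i + 1)) p2 → G.Adj p2 p3 → G.Adj p3 p4 →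
      G.Adj p4 (c i) →
      pentEdges (c i) (c (i + 1)) p2 p3 p4 = pentEdges (c 0) (c 1) (c 2) (c 3) (c 4) ∨
      ∃ j x, G.Adj (d j) x ∧ G.Adj x (d (j + 1)) ∧
        pentEdges (c i) (c (i + 1)) p2 p3 p4 =
          pentEdges (c j) (c (j + 1)) (d (j + 1)) x (d j) := by
    intro i p2 p3 p4 h1 h2 h3 h4
    rcases h.classify hcubic hg htheta hcard i h1 h2 h3 h4 with ⟨rfl, rfl, rfl⟩ | ⟨rfl, rfl⟩
    · left
      fin_cases i
      · rfl
      · exact (rot _ _ _ _ _).symm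
      · exact ((rot _ _ _ _ _).trans (rot _ _ _ _ _)).symm
      · exact (rot _ _ _ _ _).trans (rot _ _ _ _ _)
      · exact rot _ _ _ _ _
    · exact Or.inr ⟨i, p3, h3.symm, h2.symm, rfl⟩
  -- the case where `p0` is on the breaker
  have key2 : ∀ (i : Fin 5) (p1 p2 p3 p4 : V), G.Adj (c i) p1 → G.Adj p1 p2 → G.Adj p2 p3 →
      G.Adj p3 p4 → G.Adj p4 (c i) →
      pentEdges (c i) p1 p2 p3 p4 = pentEdges (c 0) (c 1) (c 2) (c 3) (c 4) ∨
      ∃ j x, G.Adj (d j) x ∧ G.Adj x (d (j + 1)) ∧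
        pentEdges (c i) p1 p2 p3 p4 =
          pentEdges (c j) (c (j + 1)) (d (j + 1)) x (d j) := by
    intro i p1 p2 p3 p4 h0 h1 h2 h3 h4
    have i4 : i + 4 + 1 = i := (by decide : ∀ i : Fin 5, i + 4 + 1 = i) i
    rcases h.cn i _ h0 with rfl | rfl | rfl
    · exact key i p2 p3 p4 h1 h2 h3 h4
    · have := key (i + 4) p4 p3 p2 (by rw [i4]; exact h4.symm) h3.symm h2.symm h1.symm
      rw [i4] at this
      rw [rev (c i), ← rot (c (i + 4))]
      exact this
    · rcases h.cn i _ h4.symm with rfl | rfl | rfl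
      · rw [rev]
        exact key i p3 p2 (d i) h3.symm h2.symm h1.symm h0.symm
      · have := key (i + 4) (d i) p2 p3 (by rw [i4]; exact h0) h1 h2 h3
        rw [i4] at this
        rwa [rot (c (i + 4))] at this
      · exact absurd (no_triangle G hg h1 h2 h3) id
  rcases pent_meets G hg _ hb h0 h1 h2 h3 h4 with
    ⟨i, rfl⟩ | ⟨i, rfl⟩ | ⟨i, rfl⟩ | ⟨i, rfl⟩ | ⟨i, rfl⟩
  · exact key2 i _ _ _ _ h0 h1 h2 h3 h4
  · rw [rot]
    exact key2 i _ _ _ _ h1 h2 h3 h4 h0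
  · rw [rot, rot]
    exact key2 i _ _ _ _ h2 h3 h4 h0 h1
  · rw [rot, rot, rot]
    exact key2 i _ _ _ _ h3 h4 h0 h1 h2
  · rw [rot, rot, rot, rot]
    exact key2 i _ _ _ _ h4 h0 h1 h2 h3

lemma Conf.final (h : Conf G c d) (hcubic : G.IsRegularOfDegree 3) (hg : 5 ≤ G.egirth)
    (htheta : ∀ X : Finset V, 7 ≤ X.card → X.card + 7 ≤ Fintype.card V →
      6 ≤ (cut G (X : Set V)).ncard)
    (hcard : 14 ≤ Fintype.card V)
    (hb : ∀ (v : V) (c' : G.Walk v v), c'.IsCycle → c'.length ≤ 5 →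
      ∃ x, x ∈ Set.range c ∧ x ∈ c'.support) :
    (shortCycleEdgeSets G).ncard ≤ 5 := by
  classical
  let P : Fin 5 → Prop := fun i => ∃ x, G.Adj (d i) x ∧ G.Adj x (d (i + 1))
  have hP : ∃ i, ¬ P i := by
    by_contra hall
    push Not at hall
    choose x hx hx' using hall
    exact h.not_all hcubic hg htheta hcard hb x hx hx'
  obtain ⟨i0, hi0⟩ := hP
  let f : Fin 5 → Finset (Sym2 V) := fun i =>
    if hi : P i then pentEdges (c i) (c (i + 1)) (d (i + 1)) hi.choose (d i) else ∅
  let S : Finset (Finset (Sym2 V)) :=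
    insert (pentEdges (c 0) (c 1) (c 2) (c 3) (c 4)) ((Finset.univ.erase i0).image f)
  have hS : S.card ≤ 5 := by
    refine (Finset.card_insert_le _ _).trans ?_
    have h1 : ((Finset.univ.erase i0).image f).card ≤ (Finset.univ.erase i0).card :=
      Finset.card_image_le
    have h2 : (Finset.univ.erase i0).card = 4 := by
      rw [Finset.card_erase_of_mem (Finset.mem_univ _)]; rfl
    omega
  refine le_trans ?_ hS
  rw [← Set.ncard_coe_finset]
  refine Set.ncard_le_ncard ?_ (Finset.finite_toSet _)
  rintro s ⟨u, w, hw, hl, rfl⟩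
  obtain ⟨q1, q2, q3, q4, h1, h2, h3, h4, h5, he, -⟩ := short_is_pent G hg w hw hl
  rw [he]
  simp only [S, Finset.coe_insert, Set.mem_insert_iff, Finset.mem_coe, Finset.mem_image,
    Finset.mem_erase, Finset.mem_univ, and_true]
  rcases h.short hcubic hg htheta hcard hb h1 h2 h3 h4 h5 with h' | ⟨i, x, hx, hx', h'⟩
  · exact Or.inl h'
  · right
    have hPi : P i := ⟨x, hx, hx'⟩
    refine ⟨i, fun e => hi0 (e ▸ hPi), ?_⟩
    rw [h']
    have hch := hPi.choose_spec
    have : hPi.choose = x := by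
      by_contra hne
      refine no_square G hg hch.1 hch.2 hx'.symm hx.symm ?_ hne
      intro e
      exact absurd (h.dinj e) ((by decide : ∀ i : Fin 5, i ≠ i + 1) i)
    simp only [f, dif_pos hPi, this]

end final

/-- A theta-connected cubic graph of girth at least 5 with at least 14
vertices having a breaker has at most five short cycles. -/
theorem theta_connected_at_most_five_short_cycles {V : Type*} [Fintype V] [DecidableEq V]
    (G : SimpleGraph V) [DecidableRel G.Adj]
    (hcubic : G.IsRegularOfDegree 3) (hgirth : 5 ≤ G.egirth)
    (htheta : ∀ X : Set V, 7 ≤ X.ncard → 7 ≤ Xᶜ.ncard → 6 ≤ (cut G X).ncard)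
    (hcard : 14 ≤ Fintype.card V)
    (hbreaker : ∃ (u : V) (c : G.Walk u u), c.IsCycle ∧ c.length ≤ 5 ∧
      ∀ (v : V) (c' : G.Walk v v), c'.IsCycle → c'.length ≤ 5 →
        ∃ x, x ∈ c.support ∧ x ∈ c'.support) :
    (shortCycleEdgeSets G).ncard ≤ 5 := by
  obtain ⟨u, w, hw, hl, hb⟩ := hbreaker
  obtain ⟨q1, q2, q3, q4, h1, h2, h3, h4, h5, -, hsup⟩ := short_is_pent G hgirth w hw hl
  obtain ⟨d, h⟩ := exists_conf G hcubic hgirth ![u, q1, q2, q3, q4] (by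
    intro i
    fin_cases i <;> simpa)
  have hb' : ∀ (v : V) (c' : G.Walk v v), c'.IsCycle → c'.length ≤ 5 →
      ∃ x, x ∈ Set.range ![u, q1, q2, q3, q4] ∧ x ∈ c'.support := by
    intro v c' h1 h2
    obtain ⟨x, hx, hx'⟩ := hb v c' h1 h2
    refine ⟨x, ?_, hx'⟩
    rw [hsup] at hx
    simp only [List.mem_cons, List.not_mem_nil, or_false] at hx
    rcases hx with rfl | rfl | rfl | rfl | rfl | rfl
    · exact ⟨0, rfl⟩
    · exact ⟨1, rfl⟩
    · exact ⟨2, rfl⟩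
    · exact ⟨3, rfl⟩
    · exact ⟨4, rfl⟩
    · exact ⟨0, rfl⟩
  refine h.final hcubic hgirth (fun X hX hX' => ?_) hcard hb'
  refine htheta X (by rwa [Set.ncard_coe_finset]) ?_
  rw [← Finset.coe_compl, Set.ncard_coe_finset, Finset.card_compl]
  omega
end

section
/- Let G be a cubic graph on 16 vertices of girth at least 6 and let X \subseteq V(G) with |X| = 8 and |\delta(X)| = 6 such that both G|X and G \ X contain cycles. Then G|X is isomorphic to the union of three internally disjoint paths on four vertices each with the same pair of ends (i.e., a theta-like graph: two degree-3 vertices joined by three paths of length 3). -/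
/-- The theta-like graph: two vertices (`0` and `7`) joined by three internally disjoint
paths on four vertices each (`0-1-2-7`, `0-3-4-7`, `0-5-6-7`). -/
def thetaGraph : SimpleGraph (Fin 8) :=
  SimpleGraph.fromEdgeSet
    {s(0, 1), s(1, 2), s(2, 7), s(0, 3), s(3, 4), s(4, 7), s(0, 5), s(5, 6), s(6, 7)}

section Helpers

variable {V : Type*} [Fintype V] [DecidableEq V] (G : SimpleGraph V) [DecidableRel G.Adj]

/-- Neighbours of `v` inside `S`. -/
def nbIn (S : Finset V) (v : V) : Finset V := S.filter (fun u => G.Adj v u)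

theorem no_three (hg : 6 ≤ G.egirth) (a b c : V) (h1 : G.Adj a b) (h2 : G.Adj b c)
    (h3 : G.Adj c a) : False := by
  have hc : (SimpleGraph.Walk.cons h1 (.cons h2 (.cons h3 .nil))).IsCycle := by
    have := h1.ne; have := h2.ne; have := h3.ne
    rw [SimpleGraph.Walk.cons_isCycle_iff]
    simp [SimpleGraph.Walk.cons_isPath_iff]
    grind
  have h := hg.trans (SimpleGraph.egirth_le_length hc)
  simp at h
  exact absurd h (by decide)

theorem no_four (hg : 6 ≤ G.egirth) (a b c d : V) (h1 : G.Adj a b) (h2 : G.Adj b c)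
    (h3 : G.Adj c d) (h4 : G.Adj d a) : a = c ∨ b = d := by
  by_contra! hne
  obtain ⟨hac, hbd⟩ := hne
  have hc : (SimpleGraph.Walk.cons h1 (.cons h2 (.cons h3 (.cons h4 .nil)))).IsCycle := by
    have := h1.ne; have := h2.ne; have := h3.ne; have := h4.ne
    rw [SimpleGraph.Walk.cons_isCycle_iff]
    simp [SimpleGraph.Walk.cons_isPath_iff]
    grind
  have h := hg.trans (SimpleGraph.egirth_le_length hc)
  simp at h
  exact absurd h (by decide)

theorem no_five (hg : 6 ≤ G.egirth) (a b c d e : V) (h1 : G.Adj a b) (h2 : G.Adj b c)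
    (h3 : G.Adj c d) (h4 : G.Adj d e) (h5 : G.Adj e a) : False := by
  have hac : a ≠ c := by rintro rfl; exact no_three G hg _ _ _ h3 h4 h5
  have had : a ≠ d := by rintro rfl; exact no_three G hg _ _ _ h1 h2 h3
  have hbd : b ≠ d := by rintro rfl; exact no_three G hg _ _ _ h1 h4 h5
  have hbe : b ≠ e := by rintro rfl; exact no_three G hg _ _ _ h2 h3 h4
  have hce : c ≠ e := by rintro rfl; exact no_three G hg _ _ _ h1 h2 h5
  have hc : (SimpleGraph.Walk.cons h1 (.cons h2 (.cons h3 (.cons h4 (.cons h5 .nil))))).IsCycle := by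
    have := h1.ne; have := h2.ne; have := h3.ne; have := h4.ne; have := h5.ne
    rw [SimpleGraph.Walk.cons_isCycle_iff]
    simp [SimpleGraph.Walk.cons_isPath_iff]
    grind
  have h := hg.trans (SimpleGraph.egirth_le_length hc)
  simp at h
  exact absurd h (by decide)

/-- `S` spans the theta pattern. -/
def IsTheta (S : Finset V) : Prop :=
  ∃ v a a' b b' c c' w : V,
    [v, a, a', b, b', c, c', w].Nodup ∧ S = {v, a, a', b, b', c, c', w} ∧
    G.Adj v a ∧ G.Adj a a' ∧ G.Adj a' w ∧ G.Adj v b ∧ G.Adj b b' ∧ G.Adj b' w ∧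
    G.Adj v c ∧ G.Adj c c' ∧ G.Adj c' w

theorem theta_of_min_deg (hg : 6 ≤ G.egirth) (S : Finset V) (hS : S.card ≤ 8)
    (hmin : ∀ v ∈ S, 2 ≤ (nbIn G S v).card) (v : V) (hv : v ∈ S)
    (hv3 : 3 ≤ (nbIn G S v).card) : IsTheta G S := by
  have h3 := no_three G hg
  have h4 := no_four G hg
  have h5 := no_five G hg
  have hsy : ∀ x y, G.Adj x y → G.Adj y x := fun _ _ h => h.symm
  have hirr : ∀ x, ¬ G.Adj x x := fun x => G.irrefl
  -- every vertex has a neighbour avoiding a given one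
  have hother : ∀ x ∈ S, ∀ y, ∃ z ∈ S, G.Adj x z ∧ z ≠ y := by
    intro x hx y
    obtain ⟨z, hz, hzy⟩ := Finset.exists_mem_ne (s := nbIn G S x) (by have := hmin x hx; omega) y
    simp only [nbIn, Finset.mem_filter] at hz
    exact ⟨z, hz.1, hz.2, hzy⟩
  obtain ⟨a, b, c, ha, hb, hc, hab, hac, hbc⟩ := Finset.two_lt_card_iff.1 hv3
  simp only [nbIn, Finset.mem_filter] at ha hb hc
  obtain ⟨haS, ha⟩ := ha
  obtain ⟨hbS, hb⟩ := hb
  obtain ⟨hcS, hc⟩ := hc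
  obtain ⟨a', haS', ha', hav⟩ := hother a haS v
  obtain ⟨b', hbS', hb', hbv⟩ := hother b hbS v
  obtain ⟨c', hcS', hc', hcv⟩ := hother c hcS v
  have hnd7 : [v, a, a', b, b', c, c'].Nodup := by
    have e1 : a' ≠ b' := by rintro rfl; grind
    have e2 : a' ≠ c' := by rintro rfl; grind
    have e3 : b' ≠ c' := by rintro rfl; grind
    have n1 : v ≠ a := ha.ne
    have n2 : v ≠ b := hb.ne
    have n3 : v ≠ c := hc.ne
    have f1 : a ≠ a' := ha'.ne
    have f2 : a ≠ b' := by rintro rfl; exact h3 _ _ _ hb hb' ha.symm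
    have f3 : a ≠ c' := by rintro rfl; exact h3 _ _ _ hc hc' ha.symm
    have g1 : b ≠ b' := hb'.ne
    have g2 : b ≠ a' := by rintro rfl; exact h3 _ _ _ ha ha' hb.symm
    have g3 : b ≠ c' := by rintro rfl; exact h3 _ _ _ hc hc' hb.symm
    have k1 : c ≠ c' := hc'.ne
    have k2 : c ≠ a' := by rintro rfl; exact h3 _ _ _ ha ha' hc.symm
    have k3 : c ≠ b' := by rintro rfl; exact h3 _ _ _ hb hb' hc.symm
    simp only [List.nodup_cons, List.mem_cons, List.not_mem_nil, not_or, List.nodup_nil]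
    simp only [not_false_eq_true, and_true]
    refine ⟨⟨n1, hav.symm, n2, hbv.symm, n3, hcv.symm⟩, ⟨f1, hab, f2, hac, f3⟩,
      ⟨g2.symm, e1, k2.symm, e2⟩, ⟨g1, hbc, g3⟩, ⟨k3.symm, e3⟩, k1⟩
  obtain ⟨p, hpS, hp, hpa⟩ := hother a' haS' a
  obtain ⟨q, hqS, hq, hqb⟩ := hother b' hbS' b
  obtain ⟨r, hrS, hr, hrc⟩ := hother c' hcS' c
  set T : Finset V := {v, a, a', b, b', c, c'} with hT
  have hTS : T ⊆ S := by
    intro x; simp only [hT, Finset.mem_insert, Finset.mem_singleton]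
    rintro (rfl | rfl | rfl | rfl | rfl | rfl | rfl) <;> assumption
  have hTc : T.card = 7 := by
    have := List.toFinset_card_of_nodup hnd7
    simpa [hT] using this
  have hpT : p ∉ T := by
    simp only [hT, Finset.mem_insert, Finset.mem_singleton]
    rintro (rfl | rfl | rfl | rfl | rfl | rfl | rfl)
    · exact h3 _ _ _ ha ha' hp
    · exact hpa rfl
    · exact hirr _ hp
    · rcases h4 _ _ _ _ ha ha' hp hb.symm with h | h
      · exact hav h.symm
      · exact hab h
    · exact h5 _ _ _ _ _ ha ha' hp hb'.symm hb.symm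
    · rcases h4 _ _ _ _ ha ha' hp hc.symm with h | h
      · exact hav h.symm
      · exact hac h
    · exact h5 _ _ _ _ _ ha ha' hp hc'.symm hc.symm
  have hqT : q ∉ T := by
    simp only [hT, Finset.mem_insert, Finset.mem_singleton]
    rintro (rfl | rfl | rfl | rfl | rfl | rfl | rfl)
    · exact h3 _ _ _ hb hb' hq
    · rcases h4 _ _ _ _ hb hb' hq ha.symm with h | h
      · exact hbv h.symm
      · exact hab h.symm
    · exact h5 _ _ _ _ _ hb hb' hq ha'.symm ha.symm
    · exact hqb rfl
    · exact hirr _ hq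
    · rcases h4 _ _ _ _ hb hb' hq hc.symm with h | h
      · exact hbv h.symm
      · exact hbc h
    · exact h5 _ _ _ _ _ hb hb' hq hc'.symm hc.symm
  have hrT : r ∉ T := by
    simp only [hT, Finset.mem_insert, Finset.mem_singleton]
    rintro (rfl | rfl | rfl | rfl | rfl | rfl | rfl)
    · exact h3 _ _ _ hc hc' hr
    · rcases h4 _ _ _ _ hc hc' hr ha.symm with h | h
      · exact hcv h.symm
      · exact hac h.symm
    · exact h5 _ _ _ _ _ hc hc' hr ha'.symm ha.symm
    · rcases h4 _ _ _ _ hc hc' hr hb.symm with h | h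
      · exact hcv h.symm
      · exact hbc h.symm
    · exact h5 _ _ _ _ _ hc hc' hr hb'.symm hb.symm
    · exact hrc rfl
    · exact hirr _ hr
  have hST : S = insert p T := by
    symm
    apply Finset.eq_of_subset_of_card_le
    · exact Finset.insert_subset hpS hTS
    · rw [Finset.card_insert_of_notMem hpT, hTc]; exact hS
  have hqp : q = p := by
    rw [hST] at hqS
    exact (Finset.mem_insert.1 hqS).resolve_right hqT
  have hrp : r = p := by
    rw [hST] at hrS
    exact (Finset.mem_insert.1 hrS).resolve_right hrT
  subst hqp
  subst hrp
  refine ⟨v, a, a', b, b', c, c', r, ?_, ?_, ha, ha', hp, hb, hb', hq, hc, hc', hr⟩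
  · have : [v, a, a', b, b', c, c', r] = [v, a, a', b, b', c, c'] ++ [r] := rfl
    rw [this, List.nodup_append]
    refine ⟨hnd7, by simp, ?_⟩
    intro x hx y hy hxy
    simp only [List.mem_singleton] at hy
    subst hy; subst hxy
    exact hrT (by simpa [hT] using hx)
  · rw [hST, hT]; ext x; simp only [Finset.mem_insert, Finset.mem_singleton]
    clear * -
    constructor
    · rintro (h | h | h | h | h | h | h | h) <;> simp [h]
    · rintro (h | h | h | h | h | h | h | h) <;> simp [h]

theorem theta_of_sum (hg : 6 ≤ G.egirth) : ∀ (n : ℕ) (S : Finset V), S.card = n → n ≤ 8 →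
    2 * n + 2 ≤ ∑ v ∈ S, (nbIn G S v).card → IsTheta G S ∧ n = 8 := by
  intro n
  induction n with
  | zero =>
    intro S hS _ h
    rw [Finset.card_eq_zero] at hS
    subst hS
    simp at h
  | succ n ih =>
    intro S hS hn h
    by_cases hmin : ∀ v ∈ S, 2 ≤ (nbIn G S v).card
    · obtain ⟨v, hv, hv3⟩ : ∃ v ∈ S, 3 ≤ (nbIn G S v).card := by
        by_contra! hcon
        have : ∑ v ∈ S, (nbIn G S v).card ≤ ∑ v ∈ S, 2 :=
          Finset.sum_le_sum fun v hv => by have := hcon v hv; omega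
        simp at this
        omega
      have hth := theta_of_min_deg G hg S (by omega) hmin v hv hv3
      refine ⟨hth, ?_⟩
      obtain ⟨v, a, a', b, b', c, c', w, hnd, hSS, -⟩ := hth
      have := List.toFinset_card_of_nodup hnd
      rw [← hS, hSS]
      simpa using this
    · exfalso
      push Not at hmin
      obtain ⟨v, hv, hv1⟩ := hmin
      have hcard : (S.erase v).card = n := by rw [Finset.card_erase_of_mem hv, hS]; rfl
      have key : ∀ u ∈ S.erase v, (nbIn G S u).card =
          (nbIn G (S.erase v) u).card + (if G.Adj v u then 1 else 0) := by
        intro u hu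
        have : nbIn G (S.erase v) u = (nbIn G S u).erase v := by
          unfold nbIn; rw [Finset.filter_erase]
        rw [this]
        split_ifs with huv
        · have hm : v ∈ nbIn G S u := by simp [nbIn, hv, huv.symm]
          rw [Finset.card_erase_add_one hm]
        · have hm : v ∉ nbIn G S u := by
            simp only [nbIn, Finset.mem_filter, not_and]; exact fun _ h => huv h.symm
          rw [Finset.erase_eq_of_notMem hm]; rfl
      have hs : ∑ u ∈ S.erase v, (if G.Adj v u then 1 else 0) = (nbIn G S v).card := by
        rw [← Finset.card_filter, nbIn, Finset.filter_erase, Finset.erase_eq_of_notMem]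
        simp
      have hsum := Finset.add_sum_erase S (fun u => (nbIn G S u).card) hv
      rw [Finset.sum_congr rfl key, Finset.sum_add_distrib, hs] at hsum
      have := ih (S.erase v) hcard (by omega) (by omega)
      omega

theorem sum_nbIn (hcubic : G.IsRegularOfDegree 3) (S : Finset V) :
    ∑ v ∈ S, (nbIn G S v).card + (cut G (S : Set V)).ncard = 3 * S.card := by
  have hcutc : (cut G (S : Set V)).ncard = ∑ v ∈ S, (Sᶜ.filter (fun u => G.Adj v u)).card := by
    rw [← Finset.card_sigma]
    have himg : cut G (S : Set V) =
        ((S.sigma fun v => Sᶜ.filter (fun u => G.Adj v u)).image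
          (fun p : (_ : V) × V => s(p.1, p.2)) : Finset (Sym2 V)) := by
      ext e
      simp only [cut, Set.mem_ofPred_eq, Finset.coe_image, Set.mem_image, Finset.mem_coe,
        Finset.mem_sigma, Finset.mem_filter, Finset.mem_compl]
      constructor
      · rintro ⟨he, x, hx, y, hy, rfl⟩
        exact ⟨⟨x, y⟩, ⟨hx, hy, he⟩, rfl⟩
      · rintro ⟨⟨x, y⟩, ⟨hx, hy, he⟩, rfl⟩
        exact ⟨he, x, hx, y, hy, rfl⟩
    rw [himg, Set.ncard_coe_finset, Finset.card_image_of_injOn]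
    rintro ⟨x, y⟩ h ⟨x', y'⟩ h' heq
    simp only [Finset.mem_coe, Finset.mem_sigma, Finset.mem_filter, Finset.mem_compl] at h h'
    rcases Sym2.eq_iff.1 heq with ⟨h1, h2⟩ | ⟨h1, h2⟩
    · simp only at h1 h2
      subst h1; subst h2; rfl
    · simp only at h1 h2
      subst h1; exact absurd h.1 h'.2.1
  rw [hcutc, ← Finset.sum_add_distrib, mul_comm, ← smul_eq_mul, ← Finset.sum_const]
  apply Finset.sum_congr rfl
  intro v _
  rw [← hcubic v, ← SimpleGraph.card_neighborFinset_eq_degree, nbIn,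
    ← Finset.card_union_of_disjoint]
  · congr 1
    ext u
    simp only [Finset.mem_union, Finset.mem_filter, Finset.mem_compl,
      SimpleGraph.mem_neighborFinset]
    tauto
  · rw [Finset.disjoint_left]
    intro u hu hu'
    simp only [Finset.mem_filter, Finset.mem_compl] at hu hu'
    exact hu'.1 hu.1

end Helpers

instance : DecidableRel thetaGraph.Adj := fun a b => by
  unfold thetaGraph
  simp only [SimpleGraph.fromEdgeSet_adj, Set.mem_insert_iff, Set.mem_singleton_iff]
  infer_instance

/-- In a cubic graph on 16 vertices of girth at least 6, if `|X| = 8`,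
`|δ(X)| = 6`, and both `G|X` and `G \ X` contain cycles, then `G|X` is isomorphic to the
union of three internally disjoint paths on four vertices with common ends. -/
theorem eight_vertex_side_is_theta {V : Type*} [Fintype V] [DecidableEq V]
    (G : SimpleGraph V) [DecidableRel G.Adj]
    (hcubic : G.IsRegularOfDegree 3) (hgirth : 6 ≤ G.egirth)
    (hcard : Fintype.card V = 16) (X : Set V)
    (hX : X.ncard = 8) (hcut : (cut G X).ncard = 6)
    (hcyc₁ : ∃ (x : X) (w : (G.induce X).Walk x x), w.IsCycle)
    (hcyc₂ : ∃ (y : ↥Xᶜ) (w : (G.induce Xᶜ).Walk y y), w.IsCycle) :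
    Nonempty (G.induce X ≃g thetaGraph) := by
  classical
  obtain ⟨S, rfl⟩ : ∃ S : Finset V, X = S := ⟨X.toFinset, by simp⟩
  rw [Set.ncard_coe_finset] at hX
  have hsum := sum_nbIn G hcubic S
  obtain ⟨⟨v, a, a', b, b', c, c', w, hnd, hS, h1, h2, h3, h4, h5, h6, h7, h8, h9⟩, -⟩ :=
    theta_of_sum G hgirth 8 S hX le_rfl (by omega)
  have t3 := no_three G hgirth
  have t4 := no_four G hgirth
  have t5 := no_five G hgirth
  let l : List V := [v, a, a', b, b', c, c', w]
  let f : Fin 8 → V := fun i => l.get i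
  have hfinj : Function.Injective f := List.nodup_iff_injective_get.1 hnd
  have hfS : ∀ i, f i ∈ (S : Set V) := by
    intro i
    have : f i ∈ l := List.get_mem l i
    rw [hS]; simpa [l] using this
  have hbij : Function.Bijective (fun i => (⟨f i, hfS i⟩ : (S : Set V))) := by
    constructor
    · intro i j hij
      exact hfinj (by simpa using hij)
    · rintro ⟨x, hx⟩
      have hx' : x ∈ l := by rw [hS] at hx; simpa [l] using hx
      obtain ⟨i, hi⟩ := List.get_of_mem hx'
      exact ⟨i, Subtype.ext hi⟩
  have hadj : ∀ i j, thetaGraph.Adj i j → G.Adj (f i) (f j) := by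
    intro i j hij
    simp only [thetaGraph, SimpleGraph.fromEdgeSet_adj, Set.mem_insert_iff,
      Set.mem_singleton_iff, Sym2.eq_iff] at hij
    obtain ⟨hij, -⟩ := hij
    rcases hij with h | h | h | h | h | h | h | h | h <;> rcases h with ⟨rfl, rfl⟩ | ⟨rfl, rfl⟩ <;>
      first
      | assumption
      | (apply SimpleGraph.Adj.symm; assumption)
  -- in the theta graph any two distinct nonadjacent vertices lie on a short closed walk
  have hcomb : ∀ i j, ¬ thetaGraph.Adj i j → i ≠ j →
      (∃ k, thetaGraph.Adj i k ∧ thetaGraph.Adj k j) ∨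
      (∃ k m, thetaGraph.Adj i k ∧ thetaGraph.Adj k m ∧ thetaGraph.Adj m j ∧ i ≠ m ∧ k ≠ j) := by
    decide
  refine ⟨RelIso.symm ⟨Equiv.ofBijective _ hbij, ?_⟩⟩
  intro i j
  simp only [Equiv.ofBijective_apply, SimpleGraph.comap_adj, Function.Embedding.subtype_apply]
  refine ⟨fun h => ?_, hadj i j⟩
  by_contra hn
  have hne : i ≠ j := by rintro rfl; exact G.irrefl h
  rcases hcomb i j hn hne with ⟨k, hk1, hk2⟩ | ⟨k, m, hk1, hk2, hk3, him, hkj⟩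
  · exact t3 _ _ _ (hadj _ _ hk1) (hadj _ _ hk2) h.symm
  · rcases t4 _ _ _ _ (hadj _ _ hk1) (hadj _ _ hk2) (hadj _ _ hk3) h.symm with e | e
    · exact him (hfinj e)
    · exact hkj (hfinj e)
end
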